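/- arXiv:2201.02354 — 2 statements merged into one kernel-verified Lean document; each statement's English description precedes it below -/
import Mathlib

section
/- For every θ ∈ (0, 1/2], ∫₀¹ (1 − f_θ(2λ − 1))² dλ = (2/3)θ. (This is the mixup loss contribution of mixing the two class-1 points x₁ = −1 and x₃ = +1 in the manifold-intrusion example: the mixed point is x^mix = 2λ − 1 with one-hot label (1,0), and the mean-squared-error loss between this label and the prediction (f_θ, 1−f_θ) is averaged over a uniformly random mixing coefficient λ ∈ [0,1].) -/
/-- Mixup loss contribution of mixing the two class-1 points x₁ = −1 and x₃ = +1 in the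
manifold-intrusion example, for the classifier f_θ. -/
theorem stmt2 (θ : ℝ) (hθ : θ ∈ Set.Ioc (0:ℝ) (1/2)) (f : ℝ → ℝ)
    (hf1 : ∀ x : ℝ, |x| ≤ 2 * θ → f x = |x| / (2 * θ))
    (hf2 : ∀ x : ℝ, 2 * θ ≤ |x| → f x = 1) :
    ∫ lam in (0:ℝ)..1, (1 - f (2 * lam - 1)) ^ 2 = (2/3) * θ := by
  obtain ⟨h0, h1⟩ := hθ
  have hf : f = fun x => min (|x| / (2 * θ)) 1 := by
    funext x
    rcases le_total |x| (2 * θ) with h | h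
    · rw [hf1 x h, min_eq_left]
      rw [div_le_one (by linarith)]; exact h
    · rw [hf2 x h, min_eq_right]
      rw [one_le_div (by linarith)]; exact h
  have hc : Continuous (fun lam : ℝ => (1 - f (2 * lam - 1)) ^ 2) := by
    rw [hf]; fun_prop
  have hi : ∀ a b : ℝ, IntervalIntegrable (fun lam : ℝ => (1 - f (2 * lam - 1)) ^ 2)
      MeasureTheory.volume a b := fun a b => hc.intervalIntegrable a b
  rw [← intervalIntegral.integral_add_adjacent_intervals (hi 0 (1/2 - θ)) (hi _ 1),
    ← intervalIntegral.integral_add_adjacent_intervals (hi (1/2 - θ) (1/2)) (hi _ 1),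
    ← intervalIntegral.integral_add_adjacent_intervals (hi (1/2) (1/2 + θ)) (hi _ 1)]
  have e1 : ∫ lam in (0:ℝ)..(1/2 - θ), (1 - f (2 * lam - 1)) ^ 2
      = ∫ lam in (0:ℝ)..(1/2 - θ), (0:ℝ) := by
    apply intervalIntegral.integral_congr
    intro x hx
    rw [Set.uIcc_of_le (by linarith)] at hx
    have := hf2 (2 * x - 1) (by rw [abs_of_nonpos (by linarith [hx.2])]; linarith [hx.2])
    simp [this]
  have e4 : ∫ lam in (1/2 + θ)..1, (1 - f (2 * lam - 1)) ^ 2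
      = ∫ lam in (1/2 + θ)..1, (0:ℝ) := by
    apply intervalIntegral.integral_congr
    intro x hx
    rw [Set.uIcc_of_le (by linarith)] at hx
    have := hf2 (2 * x - 1) (by rw [abs_of_nonneg (by linarith [hx.1])]; linarith [hx.1])
    simp [this]
  have e2 : ∫ lam in (1/2 - θ)..(1/2), (1 - f (2 * lam - 1)) ^ 2
      = ∫ lam in (1/2 - θ)..(1/2), (1 / θ ^ 2) * (lam - (1/2 - θ)) ^ 2 := by
    apply intervalIntegral.integral_congr
    intro x hx
    rw [Set.uIcc_of_le (by linarith)] at hx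
    have ha : |2 * x - 1| = 1 - 2 * x := by
      rw [abs_of_nonpos (by linarith [hx.2])]; ring
    have := hf1 (2 * x - 1) (by rw [ha]; linarith [hx.1])
    simp only [this, ha]
    field_simp
    ring
  have e3 : ∫ lam in (1/2)..(1/2 + θ), (1 - f (2 * lam - 1)) ^ 2
      = ∫ lam in (1/2)..(1/2 + θ), (1 / θ ^ 2) * (lam - (1/2 + θ)) ^ 2 := by
    apply intervalIntegral.integral_congr
    intro x hx
    rw [Set.uIcc_of_le (by linarith)] at hx
    have ha : |2 * x - 1| = 2 * x - 1 := abs_of_nonneg (by linarith [hx.1])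
    have := hf1 (2 * x - 1) (by rw [ha]; linarith [hx.2])
    simp only [this, ha]
    field_simp
    ring
  rw [e1, e2, e3, e4, intervalIntegral.integral_const_mul, intervalIntegral.integral_const_mul,
    intervalIntegral.integral_comp_sub_right (fun x => x ^ 2),
    intervalIntegral.integral_comp_sub_right (fun x => x ^ 2), integral_pow, integral_pow]
  simp only [intervalIntegral.integral_zero]
  field_simp
  ring
end

section
/- Let c > 0 and γ > 0 be real numbers, d ≥ 1 an integer, and λ ∈ [0, 1] with λ ≠ 1/(1 + c). Then as σ → ∞, the quantity λ₁(σ) = 1/(1 + c^d · exp(2σ²γ·((1 − c²)λ² − 2λ + 1))) converges to 0 if λ < 1/(1 + c) and converges to 1 if λ > 1/(1 + c). (With γ = c_d, this shows that in the asymptotic regime σ₁ → ∞ the GenLabel of a mixed point of two Gaussian classes becomes the hard label determined by whether the mixing coefficient λ exceeds 1/(1 + c).) -/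
open Filter

/-- In the asymptotic regime σ → ∞, the GenLabel weight
λ₁(σ) = 1/(1 + c^d·exp(2σ²γ·((1 − c²)λ² − 2λ + 1))) converges to the hard label:
0 if λ < 1/(1 + c) and 1 if λ > 1/(1 + c). -/
theorem stmt15 (c γ : ℝ) (hc : 0 < c) (hγ : 0 < γ) (d : ℕ) (hd : 1 ≤ d)
    (lam : ℝ) (hlam : lam ∈ Set.Icc (0:ℝ) 1) (hne : lam ≠ 1 / (1 + c)) :
    (lam < 1 / (1 + c) →
      Tendsto (fun σ : ℝ =>
          1 / (1 + c ^ d * Real.exp (2 * σ ^ 2 * γ * ((1 - c ^ 2) * lam ^ 2 - 2 * lam + 1))))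
        atTop (nhds 0)) ∧
    (1 / (1 + c) < lam →
      Tendsto (fun σ : ℝ =>
          1 / (1 + c ^ d * Real.exp (2 * σ ^ 2 * γ * ((1 - c ^ 2) * lam ^ 2 - 2 * lam + 1))))
        atTop (nhds 1)) := by
  obtain ⟨h0, h1⟩ := hlam
  have hcd : 0 < c ^ d := pow_pos hc d
  have hfac : (1 - c ^ 2) * lam ^ 2 - 2 * lam + 1
      = (1 - lam * (1 + c)) * ((1 - lam) + c * lam) := by ring
  have hpos : 0 < (1 - lam) + c * lam := by
    rcases h0.eq_or_lt with h | h
    · rw [← h]; norm_num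
    · have := mul_pos hc h
      linarith
  have hsq : Tendsto (fun σ : ℝ => σ ^ 2) atTop atTop := tendsto_pow_atTop two_ne_zero
  have heq : ∀ q : ℝ, (fun σ : ℝ => 2 * σ ^ 2 * γ * q) = fun σ : ℝ => σ ^ 2 * (2 * γ * q) := by
    intro q; funext σ; ring
  rw [hfac]
  constructor
  · intro h
    rw [lt_div_iff₀ (by linarith)] at h
    have hq : 0 < (1 - lam * (1 + c)) * ((1 - lam) + c * lam) := mul_pos (by linarith) hpos
    generalize (1 - lam * (1 + c)) * ((1 - lam) + c * lam) = q at hq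
    have hE : Tendsto (fun σ : ℝ => 2 * σ ^ 2 * γ * q) atTop atTop := by
      rw [heq]
      exact hsq.atTop_mul_const (by positivity)
    have hD := tendsto_atTop_add_const_left atTop (1 : ℝ)
      ((Real.tendsto_exp_atTop.comp hE).const_mul_atTop hcd)
    exact hD.const_div_atTop 1
  · intro h
    rw [div_lt_iff₀ (by linarith)] at h
    have hq : (1 - lam * (1 + c)) * ((1 - lam) + c * lam) < 0 :=
      mul_neg_of_neg_of_pos (by linarith) hpos
    generalize (1 - lam * (1 + c)) * ((1 - lam) + c * lam) = q at hq
    have hE : Tendsto (fun σ : ℝ => 2 * σ ^ 2 * γ * q) atTop atBot := by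
      rw [heq]
      exact hsq.atTop_mul_const_of_neg (mul_neg_of_pos_of_neg (by positivity) hq)
    have hD := ((Real.tendsto_exp_atBot.comp hE).const_mul (c ^ d)).const_add 1
    have hL := (tendsto_const_nhds (x := (1 : ℝ))).div hD (by norm_num)
    rw [mul_zero, add_zero, div_one] at hL
    exact hL
end
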